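/- Let 𝓚 = 𝓚' × ℝ be a cluster in ℝ^N that is the product of a cone-like cluster 𝓚' in ℝ^{N-1} with ℝ. Then the perimeter density of 𝓚 at the origin equals the perimeter density of 𝓚' at the origin; explicitly, P(𝓚; B₁)/ω_{N-1} = (P(𝓚'; B₁^{N-1})/ω_{N-2}) · (ω_{N-2}/ω_{N-1}) ∫_{-1}^1 (1-t²)^{(N-2)/2} dt = P(𝓚'; B₁^{N-1})/ω_{N-2}. -/

import Mathlib

open MeasureTheory Metric Set Pointwise

/-- `ℝ^N` as a Euclidean space. -/
abbrev Euc (N : ℕ) := EuclideanSpace ℝ (Fin N)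

/-- The divergence of a vector field, as the trace of its Fréchet derivative. -/
noncomputable def divg {N : ℕ} (X : Euc N → Euc N) (x : Euc N) : ℝ :=
  LinearMap.trace ℝ (Euc N) (fderiv ℝ X x).toLinearMap

/-- De Giorgi's relative perimeter of a set `E` in an open set `A`. -/
noncomputable def per {N : ℕ} (E A : Set (Euc N)) : ℝ :=
  sSup {c : ℝ | ∃ X : Euc N → Euc N, ContDiff ℝ 1 X ∧ (∀ x, ‖X x‖ ≤ 1) ∧
    IsCompact (tsupport X) ∧ tsupport X ⊆ A ∧ c = ∫ x in E, divg X x}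

/-- The relative perimeter of a cluster: half the sum of the chamber perimeters. -/
noncomputable def clPer {N m : ℕ} (E : Fin m → Set (Euc N)) (A : Set (Euc N)) : ℝ :=
  (∑ i, per (E i) A) / 2

/-- The volume of the unit ball in `ℝ^N`. -/
noncomputable def unitBallVol (N : ℕ) : ℝ :=
  (volume (ball (0 : Euc N) 1)).toReal

/-- The canonical projection `ℝ^{n+1} → ℝ^n` forgetting the last coordinate. -/
noncomputable def projFst {n : ℕ} (x : Euc (n + 1)) : Euc n :=
  (EuclideanSpace.equiv (Fin n) ℝ).symm fun j => x j.castSucc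


noncomputable def dpLin (n : ℕ) : (ℝ × Euc n) ≃ₗ[ℝ] Euc (n + 1) where
  toFun p := WithLp.toLp 2 (Fin.snoc (α := fun _ => ℝ) (fun j => p.2 j) p.1)
  invFun x := (x (Fin.last n), projFst x)
  map_add' p q := by
    ext i
    refine Fin.lastCases ?_ (fun j => ?_) i <;> simp
  map_smul' c p := by
    ext i
    refine Fin.lastCases ?_ (fun j => ?_) i <;> simp
  left_inv p := by
    ext i
    · simp
    · simp [projFst]
  right_inv x := by
    ext i
    refine Fin.lastCases ?_ (fun j => ?_) i <;> simp [projFst]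

noncomputable def dpJ (n : ℕ) : (ℝ × Euc n) ≃L[ℝ] Euc (n + 1) :=
  (dpLin n).toContinuousLinearEquiv

@[simp] lemma dpJ_last {n : ℕ} (p : ℝ × Euc n) : dpJ n p (Fin.last n) = p.1 := by
  simp [dpJ, dpLin]

@[simp] lemma dpJ_castSucc {n : ℕ} (p : ℝ × Euc n) (j : Fin n) :
    dpJ n p j.castSucc = p.2 j := by
  simp [dpJ, dpLin]

@[simp] lemma dpJ_proj {n : ℕ} (p : ℝ × Euc n) : projFst (dpJ n p) = p.2 := by
  ext j
  simp [projFst]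

lemma dpJ_norm_sq {n : ℕ} (p : ℝ × Euc n) : ‖dpJ n p‖ ^ 2 = ‖p.2‖ ^ 2 + p.1 ^ 2 := by
  rw [EuclideanSpace.norm_sq_eq, EuclideanSpace.norm_sq_eq, Fin.sum_univ_castSucc]
  simp

lemma dpJ_mp (n : ℕ) : MeasurePreserving (dpJ n) (volume : Measure (ℝ × Euc n)) volume := by
  have h1 := (volume_preserving_piFinSuccAbove (fun _ : Fin (n + 1) => ℝ) (Fin.last n)).symm
  have h2 := PiLp.volume_preserving_toLp (Fin (n + 1))
  have h3 := (MeasurePreserving.id (volume : Measure ℝ)).prod (PiLp.volume_preserving_ofLp (Fin n))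
  have h4 := h2.comp (h1.comp h3)
  convert! h4 using 1
  funext p
  ext i
  refine Fin.lastCases ?_ (fun j => ?_) i
  · simp [MeasurableEquiv.piFinSuccAbove, Fin.insertNthEquiv]
  · simp [MeasurableEquiv.piFinSuccAbove, Fin.insertNthEquiv]

/-- projection as continuous linear map -/
noncomputable def dpPi (n : ℕ) : Euc (n + 1) →L[ℝ] Euc n :=
  (ContinuousLinearMap.snd ℝ ℝ (Euc n)).comp ((dpJ n).symm : Euc (n+1) →L[ℝ] (ℝ × Euc n))

@[simp] lemma dpPi_apply {n : ℕ} (x : Euc (n + 1)) (j : Fin n) : dpPi n x j = x j.castSucc := by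
  obtain ⟨p, rfl⟩ := (dpJ n).surjective x
  simp [dpPi]

lemma dpPi_norm {n : ℕ} (x : Euc (n + 1)) : ‖dpPi n x‖ ≤ ‖x‖ := by
  obtain ⟨p, rfl⟩ := (dpJ n).surjective x
  have : dpPi n (dpJ n p) = p.2 := by simp [dpPi]
  rw [this]
  have := dpJ_norm_sq p
  refine le_of_sq_le_sq ?_ (norm_nonneg _)
  nlinarith [sq_nonneg p.1]

lemma divg_eq {N : ℕ} (X : Euc N → Euc N) (x : Euc N) :
    divg X x = ∑ i, (fderiv ℝ X x (EuclideanSpace.single i 1)) i := by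
  unfold divg
  rw [LinearMap.trace_eq_sum_inner _ (EuclideanSpace.basisFun (Fin N) ℝ)]
  simp [EuclideanSpace.inner_single_left]

lemma divg_continuous {N : ℕ} {X : Euc N → Euc N} (hX : ContDiff ℝ 1 X) :
    Continuous (divg X) := by
  have h : divg X = fun x => ∑ i, (fderiv ℝ X x (EuclideanSpace.single i 1)) i :=
    funext (divg_eq X)
  rw [h]
  have := hX.continuous_fderiv one_ne_zero
  fun_prop

lemma divg_hcs {N : ℕ} {X : Euc N → Euc N} (hc : HasCompactSupport X) :
    HasCompactSupport (divg X) := by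
  refine (hc.fderiv ℝ).mono' ?_
  intro x hx
  apply subset_tsupport
  intro h
  apply hx
  simp [divg, h]

lemma divg_integrable {N : ℕ} {X : Euc N → Euc N} (hX : ContDiff ℝ 1 X)
    (hc : HasCompactSupport X) : Integrable (divg X) :=
  (divg_continuous hX).integrable_of_hasCompactSupport (divg_hcs hc)

lemma divg_scale {n : ℕ} {Y : Euc n → Euc n} (hY : ContDiff ℝ 1 Y) (r : ℝ) (x : Euc n) :
    divg (fun x => Y (r • x)) x = r * divg Y (r • x) := by
  rw [divg_eq, divg_eq]
  have h : HasFDerivAt (fun x : Euc n => Y (r • x))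
      ((fderiv ℝ Y (r • x)).comp (r • ContinuousLinearMap.id ℝ (Euc n))) x := by
    refine HasFDerivAt.comp x (hY.differentiable one_ne_zero (r • x)).hasFDerivAt ?_
    exact (hasFDerivAt_id x).const_smul r
  rw [h.fderiv, Finset.mul_sum]
  simp

lemma cone_scale {n : ℕ} {C : Set (Euc n)} (hC : ∀ t : ℝ, 0 < t → t • C = C)
    {Y : Euc n → Euc n} (hY : ContDiff ℝ 1 Y) {r : ℝ} (hr : 0 < r) :
    ∫ x in C, divg (fun x => Y (r • x)) x = r * (r ^ n)⁻¹ * ∫ x in C, divg Y x := by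
  simp_rw [divg_scale hY r, integral_const_mul]
  rw [Measure.setIntegral_comp_smul_of_pos _ _ _ hr, hC r hr]
  simp [mul_assoc]

def perSet {N : ℕ} (E A : Set (Euc N)) : Set ℝ :=
  {c : ℝ | ∃ X : Euc N → Euc N, ContDiff ℝ 1 X ∧ (∀ x, ‖X x‖ ≤ 1) ∧
    IsCompact (tsupport X) ∧ tsupport X ⊆ A ∧ c = ∫ x in E, divg X x}

lemma zero_mem_perSet {N : ℕ} (E A : Set (Euc N)) : (0:ℝ) ∈ perSet E A := by
  refine ⟨fun _ => 0, contDiff_const, by simp, ?_, ?_, ?_⟩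
  · rw [show tsupport (fun _ : Euc N => (0 : Euc N)) = ∅ from tsupport_eq_empty_iff.2 rfl]
    exact isCompact_empty
  · rw [show tsupport (fun _ : Euc N => (0 : Euc N)) = ∅ from tsupport_eq_empty_iff.2 rfl]
    exact empty_subset _
  · simp [divg]

lemma slice_hasFDerivAt {n : ℕ} {X : Euc (n+1) → Euc (n+1)} (hX : ContDiff ℝ 1 X) (t : ℝ)
    (y : Euc n) : HasFDerivAt (fun y => dpPi n (X (dpJ n (t, y))))
      ((dpPi n).comp ((fderiv ℝ X (dpJ n (t, y))).comp
        (((dpJ n : (ℝ × Euc n) →L[ℝ] Euc (n+1))).comp (ContinuousLinearMap.inr ℝ ℝ (Euc n))))) y := by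
  refine (dpPi n).hasFDerivAt.comp y ?_
  refine HasFDerivAt.comp y (hX.differentiable one_ne_zero _).hasFDerivAt ?_
  refine (dpJ n : (ℝ × Euc n) →L[ℝ] Euc (n+1)).hasFDerivAt.comp y ?_
  exact hasFDerivAt_prodMk_right t y

lemma dpJ_inr {n : ℕ} (i : Fin n) : dpJ n (0, EuclideanSpace.single i 1)
    = EuclideanSpace.single i.castSucc 1 := by
  ext k
  refine Fin.lastCases ?_ (fun j => ?_) k
  · simp [(Fin.castSucc_lt_last i).ne']
  · simp

lemma dpJ_inl {n : ℕ} : dpJ n (1, 0) = EuclideanSpace.single (Fin.last n) 1 := by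
  ext k
  refine Fin.lastCases ?_ (fun j => ?_) k
  · simp
  · simp

lemma divg_split {n : ℕ} {X : Euc (n+1) → Euc (n+1)} (hX : ContDiff ℝ 1 X) (t : ℝ) (y : Euc n) :
    divg X (dpJ n (t, y)) = divg (fun y => dpPi n (X (dpJ n (t, y)))) y
      + (fderiv ℝ X (dpJ n (t, y)) (dpJ n (1, 0))) (Fin.last n) := by
  rw [divg_eq, divg_eq, Fin.sum_univ_castSucc, (slice_hasFDerivAt hX t y).fderiv, dpJ_inl]
  simp [dpJ_inr]

lemma vert_hasDerivAt {n : ℕ} {X : Euc (n+1) → Euc (n+1)} (hX : ContDiff ℝ 1 X) (t : ℝ)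
    (y : Euc n) : HasDerivAt (fun t => X (dpJ n (t, y)) (Fin.last n))
      ((fderiv ℝ X (dpJ n (t, y)) (dpJ n (1, 0))) (Fin.last n)) t := by
  have h1 : HasDerivAt (fun t : ℝ => dpJ n (t, y)) (dpJ n (1, 0)) t := by
    refine (dpJ n : (ℝ × Euc n) →L[ℝ] Euc (n+1)).hasFDerivAt.comp_hasDerivAt t ?_
    exact (hasDerivAt_id t).prodMk (hasDerivAt_const t y)
  have h2 := (hX.differentiable one_ne_zero (dpJ n (t, y))).hasFDerivAt.comp_hasDerivAt t h1
  exact (EuclideanSpace.proj (𝕜 := ℝ) (Fin.last n)).hasFDerivAt.comp_hasDerivAt t h2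

lemma dpJ_abs_lt {n : ℕ} {p : ℝ × Euc n} (h : dpJ n p ∈ ball (0 : Euc (n+1)) 1) :
    ‖p.2‖ ^ 2 + p.1 ^ 2 < 1 := by
  rw [mem_ball_zero_iff] at h
  rw [← dpJ_norm_sq]
  nlinarith [norm_nonneg (dpJ n p)]

lemma slice_contDiff {n : ℕ} {X : Euc (n+1) → Euc (n+1)} (hX : ContDiff ℝ 1 X) (t : ℝ) :
    ContDiff ℝ 1 (fun y => dpPi n (X (dpJ n (t, y)))) := by
  have : ContDiff ℝ 1 (fun y : Euc n => dpJ n (t, y)) :=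
    (dpJ n).contDiff.comp (contDiff_const.prodMk contDiff_id)
  exact (dpPi n).contDiff.comp (hX.comp this)

lemma fubini_div {n : ℕ} {X : Euc (n+1) → Euc (n+1)} (hX : ContDiff ℝ 1 X)
    (hc : HasCompactSupport X) (hs : tsupport X ⊆ ball 0 1) {C : Set (Euc n)}
    (hC : MeasurableSet C) :
    Integrable (fun t : ℝ => ∫ y in C, divg (fun y => dpPi n (X (dpJ n (t, y)))) y) ∧
    ∫ x in {x : Euc (n+1) | projFst x ∈ C}, divg X x
      = ∫ t : ℝ, ∫ y in C, divg (fun y => dpPi n (X (dpJ n (t, y)))) y := by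
  set F : ℝ × Euc n → ℝ := fun p => divg X (dpJ n p) with hF
  set G : ℝ × Euc n → ℝ := fun p =>
    (fderiv ℝ X (dpJ n p) (dpJ n (1, 0))) (Fin.last n) with hG
  have hμ : (volume : Measure ℝ).prod ((volume : Measure (Euc n)).restrict C)
      = (volume : Measure (ℝ × Euc n)).restrict (univ ×ˢ C) := by
    rw [Measure.volume_eq_prod, ← Measure.prod_restrict, Measure.restrict_univ]
  have hcf := hX.continuous_fderiv one_ne_zero
  have hGc : Continuous G := by
    have := (dpJ n).continuous
    fun_prop
  have hFc : Continuous F := (divg_continuous hX).comp (dpJ n).continuous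
  have hFs : HasCompactSupport F := (divg_hcs hc).comp_homeomorph (dpJ n).toHomeomorph
  have hGs : HasCompactSupport G := by
    have h1 : HasCompactSupport (fun p => fderiv ℝ X (dpJ n p)) :=
      (hc.fderiv ℝ).comp_homeomorph (dpJ n).toHomeomorph
    refine h1.mono ?_
    intro p hp h
    apply hp
    beta_reduce at h
    simp only [hG]
    rw [h]
    simp
  have hFi : Integrable F ((volume : Measure ℝ).prod ((volume : Measure (Euc n)).restrict C)) := by
    rw [hμ]; exact (hFc.integrable_of_hasCompactSupport hFs).restrict
  have hGi : Integrable G ((volume : Measure ℝ).prod ((volume : Measure (Euc n)).restrict C)) := by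
    rw [hμ]; exact (hGc.integrable_of_hasCompactSupport hGs).restrict
  have hH : ∀ t y, divg (fun y => dpPi n (X (dpJ n (t, y)))) y = (F - G) (t, y) := by
    intro t y
    have := divg_split hX t y
    simp only [hF, hG, Pi.sub_apply]
    linarith
  have hG0 : ∫ p, G p ∂((volume : Measure ℝ).prod ((volume : Measure (Euc n)).restrict C)) = 0 := by
    rw [integral_prod_symm _ hGi]
    have : ∀ y, ∫ t, G (t, y) = 0 := by
      intro y
      have hXz : ∀ t : ℝ, t ∉ Icc (-1:ℝ) 1 → dpJ n (t, y) ∉ tsupport X := by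
        intro t ht h
        have := dpJ_abs_lt (hs h)
        apply ht
        simp only at this
        constructor <;> nlinarith [sq_nonneg ‖y‖]
      refine integral_eq_zero_of_hasDerivAt_of_integrable (fun t => vert_hasDerivAt hX t y) ?_ ?_
      · refine Continuous.integrable_of_hasCompactSupport (hGc.comp (by fun_prop : Continuous fun t : ℝ => (t, y))) ?_
        refine HasCompactSupport.intro (K := Icc (-1:ℝ) 1) isCompact_Icc ?_
        intro t ht
        have h1 : fderiv ℝ X (dpJ n (t, y)) = 0 := by
          by_contra h
          exact hXz t ht (support_fderiv_subset ℝ h)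
        simp [hG, h1]
      · refine Continuous.integrable_of_hasCompactSupport ?_ ?_
        · have := (dpJ n).continuous
          have := hX.continuous
          fun_prop
        refine HasCompactSupport.intro (K := Icc (-1:ℝ) 1) isCompact_Icc ?_
        intro t ht
        simp [image_eq_zero_of_notMem_tsupport (hXz t ht)]
    simp [this]
  simp_rw [hH]
  refine ⟨(hFi.sub hGi).integral_prod_left, ?_⟩
  rw [← integral_prod _ (hFi.sub hGi)]
  simp only [Pi.sub_apply]
  rw [integral_sub hFi hGi, hG0, sub_zero, hμ]
  rw [← (dpJ_mp n).setIntegral_preimage_emb (dpJ n).toHomeomorph.measurableEmbedding]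
  congr 2
  ext p
  simp

noncomputable def dpS (t : ℝ) : ℝ := √(1 - t ^ 2)

lemma dpS_cont : Continuous dpS := by unfold dpS; fun_prop

lemma dpS_pos {t : ℝ} (ht : |t| < 1) : 0 < dpS t := by
  apply Real.sqrt_pos.2
  rw [abs_lt] at ht
  nlinarith

lemma dpS_sq {t : ℝ} (ht : |t| < 1) : dpS t ^ 2 = 1 - t ^ 2 := by
  apply Real.sq_sqrt
  rw [abs_lt] at ht
  nlinarith

lemma slice_le {k : ℕ} {C : Set (Euc (k+1))} (hC : ∀ t : ℝ, 0 < t → t • C = C)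
    (hb : BddAbove (perSet C (ball 0 1)))
    {X : Euc (k+1+1) → Euc (k+1+1)} (hX : ContDiff ℝ 1 X) (h1 : ∀ x, ‖X x‖ ≤ 1)
    (hs : tsupport X ⊆ ball 0 1) {t : ℝ} (ht : |t| < 1) :
    ∫ y in C, divg (fun y => dpPi (k+1) (X (dpJ (k+1) (t, y)))) y ≤ dpS t ^ k * per C (ball 0 1) := by
  have sp := dpS_pos ht
  have hsc := cone_scale hC (slice_contDiff hX t) sp
  have hcd := (slice_contDiff hX t).comp (contDiff_const_smul (𝕜 := ℝ) (n := 1) (F := Euc (k+1)) (dpS t))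
  set s := dpS t with hsdef
  set Y : Euc (k+1) → Euc (k+1) := fun y => dpPi (k+1) (X (dpJ (k+1) (t, y))) with hY
  have hsub : tsupport (fun y => Y (s • y)) ⊆ {y | dpJ (k+1) (t, s • y) ∈ tsupport X} := by
    refine closure_minimal ?_ ?_
    · intro y hy
      apply subset_tsupport
      intro h
      apply hy
      simp [hY, h]
    · refine (isClosed_tsupport X).preimage ?_
      have := (dpJ (k+1)).continuous
      fun_prop
  have hsub2 : tsupport (fun y => Y (s • y)) ⊆ ball 0 1 := by
    intro y hy
    have h2 := dpJ_abs_lt (hs (hsub hy))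
    simp only [norm_smul, Real.norm_eq_abs, mul_pow, sq_abs] at h2
    have h3 := dpS_sq ht
    rw [← hsdef] at h3
    rw [mem_ball_zero_iff]
    have h4 : 0 < s ^ 2 := by positivity
    have h5 : ‖y‖ ^ 2 < 1 := by
      by_contra h
      push Not at h
      nlinarith
    nlinarith [norm_nonneg y]
  have hmem : ∫ y in C, divg (fun y => Y (s • y)) y ∈ perSet C (ball 0 1) := by
    refine ⟨fun y => Y (s • y), hcd, fun y => (dpPi_norm _).trans (h1 _), ?_, hsub2, rfl⟩
    exact (isCompact_closedBall (0 : Euc (k+1)) 1).of_isClosed_subset (isClosed_tsupport _)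
      (hsub2.trans ball_subset_closedBall)
  have hle : ∫ y in C, divg (fun y => Y (s • y)) y ≤ per C (ball 0 1) := le_csSup hb hmem
  have : ∫ y in C, divg Y y = s ^ k * ∫ y in C, divg (fun y => Y (s • y)) y := by
    rw [hsc]
    field_simp
    ring
  rw [this]
  gcongr

lemma upper {k : ℕ} {C : Set (Euc (k+1))} (hm : MeasurableSet C)
    (hC : ∀ t : ℝ, 0 < t → t • C = C)
    (hb : BddAbove (perSet C (ball 0 1))) {c : ℝ}
    (hc : c ∈ perSet {x : Euc (k+1+1) | projFst x ∈ C} (ball 0 1)) :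
    c ≤ (∫ t in (-1:ℝ)..1, dpS t ^ k) * per C (ball 0 1) := by
  obtain ⟨X, hX, h1, hcs, hs, rfl⟩ := hc
  obtain ⟨hi, he⟩ := fubini_div hX hcs hs hm
  rw [he]
  rw [← setIntegral_eq_integral_of_forall_compl_eq_zero (s := Ioo (-1:ℝ) 1),
    intervalIntegral.integral_of_le (by norm_num), integral_Ioc_eq_integral_Ioo,
    ← integral_mul_const]
  · refine setIntegral_mono_on hi.integrableOn ?_ measurableSet_Ioo ?_
    · refine IntegrableOn.mono_set (t := Icc (-1) 1) ?_ Ioo_subset_Icc_self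
      exact (((dpS_cont.pow k).mul continuous_const).continuousOn).integrableOn_Icc
    · intro t ht
      exact slice_le hC hb hX h1 hs (abs_lt.2 ht)
  · intro t ht
    have : (fun y => dpPi (k+1) (X (dpJ (k+1) (t, y)))) = fun _ => 0 := by
      funext y
      have : X (dpJ (k+1) (t, y)) = 0 := by
        apply image_eq_zero_of_notMem_tsupport
        intro h
        have := dpJ_abs_lt (hs h)
        apply ht
        simp only at this
        constructor <;> nlinarith [sq_nonneg ‖y‖]
      simp [this]
    rw [this]
    simp [divg]

lemma divg_const_smul {n : ℕ} {Y : Euc n → Euc n} (hY : ContDiff ℝ 1 Y) (a : ℝ) (x : Euc n) :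
    divg (fun y => a • Y y) x = a * divg Y x := by
  rw [divg_eq, divg_eq, fderiv_fun_const_smul (hY.differentiable one_ne_zero x), Finset.mul_sum]
  simp

lemma cutoff {r : ℝ} (h0 : 0 < r) (h1 : r < 1) : ∃ φ : ℝ → ℝ, ∃ R : ℝ, R < 1 ∧ ContDiff ℝ 1 φ ∧
    (∀ t, 0 ≤ φ t) ∧ (∀ t, φ t ≤ 1) ∧ (∀ t ∈ Icc (-r) r, φ t = 1) ∧
    tsupport φ ⊆ closedBall 0 R := by
  let f : ContDiffBump (0:ℝ) := ⟨r, (1+r)/2, h0, by linarith⟩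
  refine ⟨f, (1+r)/2, by linarith, f.contDiff, fun t => f.nonneg, fun t => f.le_one, ?_, ?_⟩
  · intro t ht
    apply f.one_of_mem_closedBall
    simpa [abs_le] using ht
  · rw [f.tsupport_eq]

lemma lower_r {k : ℕ} {C : Set (Euc (k+1))} (hm : MeasurableSet C)
    (hC : ∀ t : ℝ, 0 < t → t • C = C) {c : ℝ} (hc0 : 0 ≤ c)
    (hc : c ∈ perSet C (ball 0 1)) {r : ℝ} (hr0 : 0 < r) (hr1 : r < 1) :
    ∃ d ∈ perSet {x : Euc (k+1+1) | projFst x ∈ C} (ball 0 1),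
      (∫ t in (-r)..r, dpS t ^ k) * c ≤ d := by
  obtain ⟨Y, hY, h1, hcs, hs, hcY⟩ := hc
  obtain ⟨φ, R, hR, hφ, hφ0, hφ1, hφr, hφs⟩ := cutoff hr0 hr1
  obtain ⟨ρ, hρ, hsρ⟩ := exists_lt_subset_ball (isClosed_tsupport Y) hs
  set X : Euc (k+1+1) → Euc (k+1+1) := fun x =>
    φ (x (Fin.last _)) • dpJ (k+1) (0, Y ((dpS (x (Fin.last _)))⁻¹ • dpPi (k+1) x)) with hXdef
  have hlast : Continuous fun x : Euc (k+1+1) => x (Fin.last (k+1)) := by fun_prop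
  have habs : ∀ t ∈ tsupport φ, |t| < 1 := by
    intro t ht
    have := hφs ht
    rw [mem_closedBall_zero_iff, Real.norm_eq_abs] at this
    linarith
  have hX : ContDiff ℝ 1 X := by
    rw [contDiff_iff_contDiffAt]
    intro x
    by_cases hx : x (Fin.last (k+1)) ∈ tsupport φ
    · have hp := dpS_pos (habs _ hx)
      have hl : ContDiffAt ℝ 1 (fun x : Euc (k+1+1) => x (Fin.last (k+1))) x := by
        exact (EuclideanSpace.proj (𝕜 := ℝ) (Fin.last (k+1))).contDiff.contDiffAt
      have hSd : ContDiffAt ℝ 1 (fun x : Euc (k+1+1) => dpS (x (Fin.last (k+1)))) x := by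
        refine ContDiffAt.sqrt (contDiffAt_const.sub (hl.pow 2)) ?_
        exact (Real.sqrt_pos.1 hp).ne'
      have h2 := hSd.inv hp.ne'
      have h3 := h2.smul (dpPi (k+1)).contDiff.contDiffAt
      have h4 : ContDiffAt ℝ 1 (fun x : Euc (k+1+1) =>
          Y ((dpS (x (Fin.last _)))⁻¹ • dpPi (k+1) x)) x := hY.contDiffAt.comp x h3
      have h5 : ContDiffAt ℝ 1 (fun x : Euc (k+1+1) => dpJ (k+1) (0,
          Y ((dpS (x (Fin.last _)))⁻¹ • dpPi (k+1) x))) x :=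
        (dpJ (k+1)).contDiff.contDiffAt.comp x (contDiffAt_const.prodMk h4)
      exact (hφ.contDiffAt.comp x hl).smul h5
    · have h2 := notMem_tsupport_iff_eventuallyEq.1 hx
      have h3 := hlast.continuousAt.eventually h2
      refine (contDiffAt_const (c := (0 : Euc (k+1+1)))).congr_of_eventuallyEq ?_
      filter_upwards [h3] with z hz
      simp only [Pi.zero_apply] at hz
      simp [hXdef, hz]
  have hX1 : ∀ x, ‖X x‖ ≤ 1 := by
    intro x
    have h2 : ∀ y : Euc (k+1), ‖dpJ (k+1) (0, y)‖ = ‖y‖ := by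
      intro y
      have := dpJ_norm_sq ((0:ℝ), y)
      simp only [ne_eq, OfNat.ofNat_ne_zero, not_false_eq_true, zero_pow, add_zero] at this
      exact (sq_eq_sq₀ (norm_nonneg _) (norm_nonneg _)).1 this
    simp only [hXdef, norm_smul, h2, Real.norm_eq_abs, abs_of_nonneg (hφ0 _)]
    exact mul_le_one₀ (hφ1 _) (norm_nonneg _) (h1 _)
  have hsub : tsupport X ⊆ {x | |x (Fin.last (k+1))| ≤ R ∧
      ‖dpPi (k+1) x‖ ≤ ρ * dpS (x (Fin.last (k+1)))} := by
    refine closure_minimal ?_ ?_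
    · intro x hx
      have hx1 : φ (x (Fin.last (k+1))) ≠ 0 := by
        intro h; apply hx; simp [hXdef, h]
      have hx2 : Y ((dpS (x (Fin.last _)))⁻¹ • dpPi (k+1) x) ≠ 0 := by
        intro h; apply hx; simp [hXdef, h]
      have ht := subset_tsupport φ hx1
      have hp := dpS_pos (habs _ ht)
      have h3 := hsρ (subset_tsupport Y hx2)
      rw [mem_ball_zero_iff, norm_smul, Real.norm_eq_abs, abs_of_pos (inv_pos.2 hp),
        inv_mul_lt_iff₀ hp] at h3
      refine ⟨?_, by linarith⟩
      simpa using hφs ht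
    · refine IsClosed.inter (isClosed_le (continuous_abs.comp hlast) continuous_const) ?_
      refine isClosed_le (dpPi (k+1)).continuous.norm ?_
      exact continuous_const.mul (dpS_cont.comp hlast)
  have hsub2 : tsupport X ⊆ ball 0 1 := by
    intro x hx
    obtain ⟨h2, h3⟩ := hsub hx
    have h4 : |x (Fin.last (k+1))| < 1 := by linarith
    have h5 := dpS_pos h4
    have h6 := dpS_sq h4
    obtain ⟨p, rfl⟩ := (dpJ (k+1)).surjective x
    have h7 : dpPi (k+1) (dpJ (k+1) p) = p.2 := by ext j; simp
    rw [h7] at h3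
    rw [dpJ_last] at *
    rw [mem_ball_zero_iff]
    have h8 := dpJ_norm_sq p
    have h9 : ‖p.2‖ < dpS p.1 := by nlinarith
    have h10 : ‖p.2‖ ^ 2 < dpS p.1 ^ 2 := by gcongr
    have h11 : ‖dpJ (k+1) p‖ ^ 2 < 1 := by linarith
    nlinarith [norm_nonneg (dpJ (k+1) p)]
  have hcX : IsCompact (tsupport X) :=
    (isCompact_closedBall (0 : Euc (k+1+1)) 1).of_isClosed_subset (isClosed_tsupport _)
      (hsub2.trans ball_subset_closedBall)
  refine ⟨_, ⟨X, hX, hX1, hcX, hsub2, rfl⟩, ?_⟩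
  obtain ⟨hi, he⟩ := fubini_div hX hcX hsub2 hm
  rw [he]
  have hval : ∀ t, ∫ y in C, divg (fun y => dpPi (k+1) (X (dpJ (k+1) (t, y)))) y
      = φ t * (dpS t ^ k * c) := by
    intro t
    have hfun : (fun y => dpPi (k+1) (X (dpJ (k+1) (t, y))))
        = fun y => φ t • Y ((dpS t)⁻¹ • y) := by
      funext y
      have h7 : dpPi (k+1) (dpJ (k+1) (t, y)) = y := by ext j; simp
      simp only [hXdef, dpJ_last, h7]
      ext j
      simp
    rw [hfun]
    have hcd : ContDiff ℝ 1 (fun y => Y ((dpS t)⁻¹ • y)) := hY.comp (contDiff_const_smul _)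
    simp_rw [divg_const_smul hcd, integral_const_mul]
    by_cases ht : φ t = 0
    · simp [ht]
    · have hp := dpS_pos (habs _ (subset_tsupport φ ht))
      rw [cone_scale hC hY (inv_pos.2 hp), ← hcY]
      rw [inv_pow, inv_inv, pow_succ]
      field_simp
  simp_rw [hval] at hi ⊢
  have hnn : ∀ t, 0 ≤ φ t * (dpS t ^ k * c) := fun t =>
    mul_nonneg (hφ0 t) (mul_nonneg (pow_nonneg (Real.sqrt_nonneg _) _) hc0)
  rw [intervalIntegral.integral_of_le (by linarith), ← integral_mul_const]
  calc ∫ t in Ioc (-r) r, dpS t ^ k * c = ∫ t in Ioc (-r) r, φ t * (dpS t ^ k * c) := by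
        refine setIntegral_congr_fun measurableSet_Ioc ?_
        intro t ht
        simp only [hφr t (Ioc_subset_Icc_self ht), one_mul]
    _ ≤ _ := setIntegral_le_integral hi (Filter.Eventually.of_forall hnn)

lemma dpInt_tendsto (k : ℕ) : Continuous (fun r : ℝ => ∫ t in (-r)..r, dpS t ^ k) := by
  have hc := dpS_cont.pow k
  have hi : ∀ a b, IntervalIntegrable (fun t => dpS t ^ k) volume a b :=
    fun a b => hc.intervalIntegrable a b
  have h : (fun r : ℝ => ∫ t in (-r)..r, dpS t ^ k) =
      fun r => (∫ t in (0:ℝ)..r, dpS t ^ k) - ∫ t in (0:ℝ)..(-r), dpS t ^ k := by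
    funext r
    rw [intervalIntegral.integral_interval_sub_left (hi _ _) (hi _ _)]
  rw [h]
  have := intervalIntegral.continuous_primitive hi 0
  exact this.sub (this.comp continuous_neg)

lemma lower {k : ℕ} {C : Set (Euc (k+1))} (hm : MeasurableSet C)
    (hC : ∀ t : ℝ, 0 < t → t • C = C) {B : ℝ}
    (hB : B ∈ upperBounds (perSet {x : Euc (k+1+1) | projFst x ∈ C} (ball 0 1)))
    {c : ℝ} (hc : c ∈ perSet C (ball 0 1)) :
    (∫ t in (-1:ℝ)..1, dpS t ^ k) * c ≤ B := by
  have hw : ∀ t, 0 ≤ dpS t ^ k := fun t => pow_nonneg (Real.sqrt_nonneg _) _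
  rcases le_total 0 c with h0 | h0
  · have ht := (((dpInt_tendsto k).mul continuous_const).tendsto (1:ℝ) (f := fun r : ℝ => (∫ t in (-r)..r, dpS t ^ k) * c)).mono_left
      (nhdsWithin_le_nhds (s := Iio 1))
    refine le_of_tendsto ht ?_
    have : Ioo (0:ℝ) 1 ∈ nhdsWithin (1:ℝ) (Iio 1) := Ioo_mem_nhdsLT (by norm_num)
    filter_upwards [this] with r hr
    obtain ⟨d, hd, hle⟩ := lower_r hm hC h0 hc hr.1 hr.2
    exact hle.trans (hB hd)
  · have h1 : 0 ≤ B := hB (zero_mem_perSet _ _)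
    have h2 : 0 ≤ ∫ t in (-1:ℝ)..1, dpS t ^ k :=
      intervalIntegral.integral_nonneg (by norm_num) (fun t _ => hw t)
    nlinarith

lemma dpInt_pos (k : ℕ) : 0 < ∫ t in (-1:ℝ)..1, dpS t ^ k := by
  refine intervalIntegral.intervalIntegral_pos_of_pos_on
    ((dpS_cont.pow k).intervalIntegrable _ _) ?_ (by norm_num)
  intro t ht
  exact pow_pos (dpS_pos (abs_lt.2 ht)) _

lemma per_prod {k : ℕ} {C : Set (Euc (k+1))} (hm : MeasurableSet C)
    (hC : ∀ t : ℝ, 0 < t → t • C = C) :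
    per {x : Euc (k+1+1) | projFst x ∈ C} (ball 0 1)
      = (∫ t in (-1:ℝ)..1, dpS t ^ k) * per C (ball 0 1) := by
  have hI := dpInt_pos k
  by_cases hb : BddAbove (perSet C (ball 0 1))
  · have hu : ∀ c ∈ perSet {x : Euc (k+1+1) | projFst x ∈ C} (ball 0 1),
        c ≤ (∫ t in (-1:ℝ)..1, dpS t ^ k) * per C (ball 0 1) := fun c hc => upper hm hC hb hc
    apply le_antisymm
    · exact csSup_le ⟨0, zero_mem_perSet _ _⟩ hu
    · rw [← le_div_iff₀' hI]
      refine csSup_le ⟨0, zero_mem_perSet _ _⟩ ?_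
      intro c hc
      rw [le_div_iff₀' hI]
      exact lower hm hC (fun d hd => le_csSup (s := perSet _ _) ⟨_, hu⟩ hd) hc
  · have hb2 : ¬ BddAbove (perSet {x : Euc (k+1+1) | projFst x ∈ C} (ball 0 1)) := by
      rintro ⟨B, hB⟩
      apply hb
      refine ⟨B / ∫ t in (-1:ℝ)..1, dpS t ^ k, ?_⟩
      intro c hc
      rw [le_div_iff₀' hI]
      exact lower hm hC hB hc
    have e1 : per C (ball 0 1) = 0 := Real.sSup_of_not_bddAbove hb
    have e2 : per {x : Euc (k+1+1) | projFst x ∈ C} (ball 0 1) = 0 :=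
      Real.sSup_of_not_bddAbove hb2
    rw [e1, e2, mul_zero]

lemma vol_succ (k : ℕ) : unitBallVol (k+1) = unitBallVol k * ∫ t in (-1:ℝ)..1, dpS t ^ k := by
  unfold unitBallVol
  rw [← (dpJ_mp k).measure_preimage measurableSet_ball.nullMeasurableSet, Measure.volume_eq_prod,
    Measure.prod_apply ((dpJ k).continuous.measurable measurableSet_ball)]
  have hsl : ∀ t : ℝ, volume (Prod.mk t ⁻¹' (dpJ k ⁻¹' ball (0 : Euc (k+1)) 1))
      = (Ioo (-1:ℝ) 1).indicator (fun t => ENNReal.ofReal (dpS t ^ k) * volume (ball (0 : Euc k) 1)) t := by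
    intro t
    by_cases ht : t ∈ Ioo (-1:ℝ) 1
    · rw [indicator_of_mem ht]
      have ht' : |t| < 1 := abs_lt.2 ht
      have hp := dpS_pos ht'
      have hset : Prod.mk t ⁻¹' (dpJ k ⁻¹' ball (0 : Euc (k+1)) 1) = ball 0 (dpS t) := by
        ext y
        simp only [mem_preimage, mem_ball_zero_iff]
        have h1 := dpJ_norm_sq (t, y)
        have h2 := dpS_sq ht'
        simp only at h1
        constructor
        · intro h
          have : ‖dpJ k (t, y)‖ ^ 2 < 1 := by nlinarith [norm_nonneg (dpJ k (t, y))]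
          exact lt_of_pow_lt_pow_left₀ 2 hp.le (by linarith)
        · intro h
          have : ‖y‖ ^ 2 < dpS t ^ 2 := by gcongr
          exact lt_of_pow_lt_pow_left₀ 2 zero_le_one (by linarith)
      rw [hset, Measure.addHaar_ball_of_pos _ _ hp]
      simp
    · rw [indicator_of_notMem ht]
      have hset : Prod.mk t ⁻¹' (dpJ k ⁻¹' ball (0 : Euc (k+1)) 1) = ∅ := by
        rw [eq_empty_iff_forall_notMem]
        intro y hy
        have := dpJ_abs_lt (show dpJ k (t, y) ∈ ball (0 : Euc (k+1)) 1 from hy)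
        apply ht
        simp only at this
        constructor <;> nlinarith [sq_nonneg ‖y‖]
      rw [hset, measure_empty]
  simp_rw [hsl]
  have hmeas : Measurable fun t => ENNReal.ofReal (dpS t ^ k) :=
    ENNReal.measurable_ofReal.comp (dpS_cont.pow k).measurable
  rw [lintegral_indicator measurableSet_Ioo, lintegral_mul_const _
    (hmeas), ENNReal.toReal_mul, mul_comm,
    intervalIntegral.integral_of_le (by norm_num), integral_Ioc_eq_integral_Ioo,
    integral_eq_lintegral_of_nonneg_ae]
  · exact Filter.Eventually.of_forall fun t => pow_nonneg (Real.sqrt_nonneg _) _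
  · exact (dpS_cont.pow k).aestronglyMeasurable

lemma vol_pos (k : ℕ) : 0 < unitBallVol k :=
  ENNReal.toReal_pos (measure_ball_pos _ _ one_pos).ne' measure_ball_lt_top.ne

lemma int_eq (k : ℕ) : (∫ t in (-1 : ℝ)..(1 : ℝ), (1 - t ^ 2) ^ (((((k + 1 : ℕ) : ℝ) + 1) - 2) / 2))
    = ∫ t in (-1:ℝ)..1, dpS t ^ k := by
  refine intervalIntegral.integral_congr ?_
  intro t ht
  rw [uIcc_of_le (by norm_num)] at ht
  have h : 0 ≤ 1 - t ^ 2 := by nlinarith [ht.1, ht.2]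
  simp only [dpS]
  rw [Real.sqrt_eq_rpow, ← Real.rpow_natCast _ k, ← Real.rpow_mul h]
  congr 1
  push_cast
  ring

/-- For the product cluster `𝓚 = 𝓚' × ℝ` in `ℝ^N` of a cone-like cluster `𝓚'` in
`ℝ^{N-1}` with `ℝ`, the perimeter density of `𝓚` at the origin equals that of `𝓚'`:
`P(𝓚;B₁)/ω_{N-1} = (P(𝓚';B₁)/ω_{N-2})·(ω_{N-2}/ω_{N-1})∫_{-1}^1(1-t²)^{(N-2)/2}dt
 = P(𝓚';B₁)/ω_{N-2}` (here `N = n+1`). -/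
theorem density_of_product_cluster
    (n m : ℕ) (hn : 1 ≤ n) (K' : Fin m → Set (Euc n))
    (hopen : ∀ i, IsOpen (K' i))
    (hcone : ∀ i, ∀ t : ℝ, 0 < t → t • K' i = K' i)
    (hdisj : ∀ i j, i ≠ j → volume (K' i ∩ K' j) = 0)
    (K : Fin m → Set (Euc (n + 1)))
    (hK : ∀ i, K i = {x : Euc (n + 1) | projFst x ∈ K' i}) :
    clPer K (ball (0 : Euc (n + 1)) 1) / unitBallVol n =
        (clPer K' (ball (0 : Euc n) 1) / unitBallVol (n - 1)) *
          ((unitBallVol (n - 1) / unitBallVol n) *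
            ∫ t in (-1 : ℝ)..(1 : ℝ), (1 - t ^ 2) ^ ((((n : ℝ) + 1) - 2) / 2)) ∧
      clPer K (ball (0 : Euc (n + 1)) 1) / unitBallVol n =
        clPer K' (ball (0 : Euc n) 1) / unitBallVol (n - 1) := by
  obtain ⟨k, rfl⟩ : ∃ k, n = k + 1 := ⟨n - 1, by omega⟩
  rw [int_eq, Nat.add_sub_cancel]
  have hI := dpInt_pos k
  have hv := vol_pos k
  have hcl : clPer K (ball (0 : Euc (k + 1 + 1)) 1)
      = (∫ t in (-1:ℝ)..1, dpS t ^ k) * clPer K' (ball (0 : Euc (k + 1)) 1) := by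
    unfold clPer
    rw [← mul_div_assoc, Finset.mul_sum]
    congr 1
    refine Finset.sum_congr rfl fun i _ => ?_
    rw [hK i]
    exact per_prod (hopen i).measurableSet (hcone i)
  rw [hcl, vol_succ k]
  constructor <;> field_simp
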